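/- arXiv:1809.01440 — 2 statements merged into one kernel-verified Lean document; each statement's English description precedes it below -/
import Mathlib

section
/- Let ℓ be a prime, N a finite free Z_ℓ-module, and Λ ⊆ End_{Z_ℓ}(N) a Z_ℓ-subalgebra. Suppose the restriction of the trace form Tr(xy) to the centralizer End_Λ(N) of Λ in End_{Z_ℓ}(N) has nonzero discriminant. Then there exists an integer r ≥ 0 such that for all n ≥ 1: ℓ^r·End_Λ(N/ℓ^n) ⊆ End_Λ(N)/ℓ^n ⊆ End_Λ(N/ℓ^n), where End_Λ(N/ℓ^n) denotes the centralizer of the image of Λ in End(N/ℓ^n). -/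
noncomputable def gramDet (R : Type) (S : Type) {M : Type} [CommRing R] [AddCommGroup M]
    [Module R M] [Module.Free R M] [Module.Finite R M] [CommRing S] (B : M → M → S) : S :=
  letI := Classical.decEq (Module.Free.ChooseBasisIndex R M)
  Matrix.det (Matrix.of fun i j => B (Module.Free.chooseBasis R M i) (Module.Free.chooseBasis R M j))

/-- The submodule `c • N`, realised as the range of scalar multiplication by `c`. -/
def smulSub {R N : Type} [CommRing R] [AddCommGroup N] [Module R N] (c : R) : Submodule R N :=
  LinearMap.range (c • (LinearMap.id : N →ₗ[R] N))

/-- The endomorphism of `N/cN` induced by an endomorphism of `N` (reduction mod `c`). -/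
noncomputable def endQuot {R N : Type} [CommRing R] [AddCommGroup N] [Module R N] (c : R)
    (f : N →ₗ[R] N) : Module.End R (N ⧸ (smulSub c : Submodule R N)) :=
  Submodule.mapQ _ _ f (by
    rintro x ⟨y, rfl⟩
    exact ⟨f y, by simp⟩)

section Reduction

variable {R N : Type} [CommRing R] [AddCommGroup N] [Module R N]

theorem endQuot_mkQ (c : R) (f : Module.End R N) (x : N) :
    endQuot c f ((smulSub c : Submodule R N).mkQ x) = (smulSub c : Submodule R N).mkQ (f x) :=
  rfl

theorem endQuot_ext (c : R) {φ ψ : Module.End R (N ⧸ (smulSub c : Submodule R N))}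
    (h : ∀ x, φ ((smulSub c).mkQ x) = ψ ((smulSub c).mkQ x)) : φ = ψ :=
  Submodule.linearMap_qext _ (LinearMap.ext h)

theorem endQuot_mul (c : R) (f g : Module.End R N) :
    endQuot c (f * g) = endQuot c f * endQuot c g :=
  endQuot_ext c fun _ => rfl

theorem endQuot_surjective [Module.Projective R N] (c : R) :
    Function.Surjective (endQuot (N := N) c) := by
  intro φ
  obtain ⟨f, hf⟩ := Module.projective_lifting_property (smulSub c : Submodule R N).mkQ
    (φ ∘ₗ (smulSub c).mkQ) (Submodule.mkQ_surjective _)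
  exact ⟨f, endQuot_ext c fun x => LinearMap.congr_fun hf x⟩

theorem exists_sub_eq_smul_of_endQuot_eq [Module.Projective R N] (c : R) {f g : Module.End R N}
    (h : endQuot c f = endQuot c g) : ∃ t : Module.End R N, f - g = c • t := by
  have hmem : ∀ x, (f - g) x ∈ (smulSub c : Submodule R N) := fun x =>
    (Submodule.Quotient.eq _).1 (LinearMap.congr_fun h ((smulSub c).mkQ x))
  obtain ⟨t, ht⟩ := Module.projective_lifting_property
    (c • (LinearMap.id : N →ₗ[R] N)).rangeRestrict ((f - g).codRestrict _ hmem)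
    (LinearMap.surjective_rangeRestrict _)
  refine ⟨t, LinearMap.ext fun x => ?_⟩
  exact (congrArg Subtype.val (LinearMap.congr_fun ht x)).symm

theorem endQuot_smul_sub_smul (a c : R) (f g : Module.End R N) :
    endQuot c (a • f - c • g) = a • endQuot c f := by
  refine endQuot_ext c fun x => ?_
  rw [LinearMap.smul_apply, endQuot_mkQ, endQuot_mkQ, ← map_smul]
  refine (Submodule.Quotient.eq _).2 ⟨-g x, ?_⟩
  simp

end Reduction

/-- In a Noetherian module, the power torsion modulo a submodule has bounded exponent. -/
theorem exists_pow_smul_mem_of_pow_smul_mem {R M : Type*} [CommRing R] [AddCommGroup M]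
    [Module R M] [IsNoetherian R M] (a : R) (S : Submodule R M) :
    ∃ r : ℕ, ∀ (n : ℕ) (x : M), a ^ n • x ∈ S → a ^ r • x ∈ S := by
  let P : ℕ →o Submodule R M :=
    { toFun := fun k => S.comap (LinearMap.lsmul R M (a ^ k))
      monotone' := by
        intro i j hij x hx
        obtain ⟨k, rfl⟩ := Nat.exists_eq_add_of_le' hij
        simp only [Submodule.mem_comap, LinearMap.lsmul_apply] at hx ⊢
        rw [pow_add, mul_smul]
        exact S.smul_mem _ hx }
  obtain ⟨r, hr⟩ := monotone_stabilizes_iff_noetherian.2 ‹IsNoetherian R M› P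
  refine ⟨r, fun n x hx => ?_⟩
  have hx' : x ∈ P (max r n) := P.monotone (le_max_right r n) hx
  rwa [← hr _ (le_max_left r n)] at hx'

/-- The commutators of an endomorphism with the members of a family. -/
def commutatorFamily {R N ι : Type*} [CommRing R] [AddCommGroup N] [Module R N]
    (s : ι → Module.End R N) : Module.End R N →ₗ[R] ι → Module.End R N :=
  LinearMap.pi fun i => LinearMap.mulRight R (s i) - LinearMap.mulLeft R (s i)

theorem commutatorFamily_apply {R N ι : Type*} [CommRing R] [AddCommGroup N] [Module R N]
    (s : ι → Module.End R N) (f : Module.End R N) (i : ι) :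
    commutatorFamily s f i = f * s i - s i * f :=
  rfl

theorem mem_centralizer_of_commutatorFamily_eq_zero {R N : Type*} [CommRing R] [AddCommGroup N]
    [Module R N] {Λ : Subalgebra R (Module.End R N)} {s : Set (Module.End R N)}
    (hs : Submodule.span R s = Subalgebra.toSubmodule Λ) {f : Module.End R N}
    (hf : commutatorFamily (fun i : s => (i : Module.End R N)) f = 0) :
    f ∈ Subalgebra.centralizer R (Λ : Set (Module.End R N)) := by
  have hle : Submodule.span R s ≤
      LinearMap.ker (LinearMap.mulLeft R f - LinearMap.mulRight R f) :=
    Submodule.span_le.2 fun i hi => congrFun hf ⟨i, hi⟩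
  rw [Subalgebra.mem_centralizer_iff]
  intro g hg
  have hg' : f * g - g * f = 0 := hle (hs ▸ hg : g ∈ Submodule.span R s)
  exact (sub_eq_zero.1 hg').symm


set_option synthInstance.maxHeartbeats 1000000 in
/-- let `ℓ` be a prime, `N` a finite free `ℤ_ℓ`-module and `Λ ⊆ End(N)`
a `ℤ_ℓ`-subalgebra such that the trace form `Tr(xy)` restricted to the centraliser
`End_Λ(N)` has nonzero discriminant. Then there is `r ≥ 0` such that for all `n ≥ 1`:
`ℓ^r·End_Λ(N/ℓⁿ) ⊆ End_Λ(N)/ℓⁿ ⊆ End_Λ(N/ℓⁿ)`, where `End_Λ(N/ℓⁿ)` is the centraliser of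
the image of `Λ` in `End(N/ℓⁿ)` and `End_Λ(N)/ℓⁿ` means the image of `End_Λ(N)` under
reduction mod `ℓⁿ`. -/
theorem stmt5 (ℓ : ℕ) [Fact ℓ.Prime]
    (N : Type) [AddCommGroup N] [Module ℤ_[ℓ] N] [Module.Free ℤ_[ℓ] N] [Module.Finite ℤ_[ℓ] N]
    (hrank : 0 < Module.finrank ℤ_[ℓ] N)
    (Λ : Subalgebra ℤ_[ℓ] (Module.End ℤ_[ℓ] N))
    (hd : gramDet ℤ_[ℓ] ℤ_[ℓ]
      (fun x y : Subalgebra.toSubmodule (Subalgebra.centralizer ℤ_[ℓ] (Λ : Set (Module.End ℤ_[ℓ] N))) =>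
        LinearMap.trace ℤ_[ℓ] N ((x : Module.End ℤ_[ℓ] N) * (y : Module.End ℤ_[ℓ] N))) ≠ 0) :
    ∃ r : ℕ, ∀ n : ℕ, 0 < n →
      (∀ f ∈ Subalgebra.centralizer ℤ_[ℓ] (Λ : Set (Module.End ℤ_[ℓ] N)), ∀ lam ∈ Λ,
        endQuot ((ℓ : ℤ_[ℓ]) ^ n) f * endQuot ((ℓ : ℤ_[ℓ]) ^ n) lam
          = endQuot ((ℓ : ℤ_[ℓ]) ^ n) lam * endQuot ((ℓ : ℤ_[ℓ]) ^ n) f) ∧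
      (∀ φ : Module.End ℤ_[ℓ] (N ⧸ (smulSub ((ℓ : ℤ_[ℓ]) ^ n) : Submodule ℤ_[ℓ] N)),
        (∀ lam ∈ Λ, φ * endQuot ((ℓ : ℤ_[ℓ]) ^ n) lam = endQuot ((ℓ : ℤ_[ℓ]) ^ n) lam * φ) →
        ∃ f ∈ Subalgebra.centralizer ℤ_[ℓ] (Λ : Set (Module.End ℤ_[ℓ] N)),
          endQuot ((ℓ : ℤ_[ℓ]) ^ n) f = (ℓ : ℤ_[ℓ]) ^ r • φ) := by
  obtain ⟨s, hs⟩ := IsNoetherian.noetherian (Subalgebra.toSubmodule Λ)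
  let D := commutatorFamily (R := ℤ_[ℓ])
    (fun i : (s : Set (Module.End ℤ_[ℓ] N)) => (i : Module.End ℤ_[ℓ] N))
  obtain ⟨r, hr⟩ := exists_pow_smul_mem_of_pow_smul_mem (ℓ : ℤ_[ℓ]) (LinearMap.range D)
  refine ⟨r, fun n _ => ⟨fun f hf lam hlam => ?_, fun φ hφ => ?_⟩⟩
  · rw [← endQuot_mul, ← endQuot_mul, (Subalgebra.mem_centralizer_iff _).1 hf lam hlam]
  · obtain ⟨x, rfl⟩ := endQuot_surjective _ φ
    have hx : ∀ i : (s : Set (Module.End ℤ_[ℓ] N)),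
        ∃ t : Module.End ℤ_[ℓ] N, x * i - i * x = (ℓ : ℤ_[ℓ]) ^ n • t := by
      intro i
      have hi : (i : Module.End ℤ_[ℓ] N) ∈ Subalgebra.toSubmodule Λ :=
        hs ▸ Submodule.subset_span i.2
      refine exists_sub_eq_smul_of_endQuot_eq _ ?_
      rw [endQuot_mul, endQuot_mul]
      exact hφ i hi
    choose t ht using hx
    have hDx : D x = (ℓ : ℤ_[ℓ]) ^ n • t := funext ht
    obtain ⟨y, hy⟩ := hr n t ⟨x, hDx⟩
    refine ⟨(ℓ : ℤ_[ℓ]) ^ r • x - (ℓ : ℤ_[ℓ]) ^ n • y,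
      mem_centralizer_of_commutatorFamily_eq_zero hs ?_, endQuot_smul_sub_smul _ _ _ _⟩
    change D _ = 0
    rw [map_sub, map_smul, map_smul, hDx, hy, smul_comm, sub_self]
end

section
/- Let k be a field finitely generated over Q and A an abelian variety over k of dimension g ≥ 1. Let Λ_ℓ(A) be the Z_ℓ-subalgebra of End_{Z_ℓ}(T_ℓ(A)) generated by the image of Galois. If the prime ℓ does not divide discr(Λ_ℓ(A)), then the Galois module A[ℓ] is semisimple, End(A)/ℓ is a semisimple F_ℓ-algebra, and End_Γ(A[ℓ]) = End(A)/ℓ. -/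
open scoped TensorProduct
set_option synthInstance.maxHeartbeats 1000000
set_option maxHeartbeats 1000000

def IsReducedTrace (K : Type) [Field K] (B : Type) [Ring B] [Algebra K B]
    (t : B →ₗ[K] K) : Prop :=
  ∃ (m : ℕ) (n : Fin m → ℕ)
    (e : (AlgebraicClosure K ⊗[K] B) ≃ₐ[AlgebraicClosure K]
      ((i : Fin m) → Matrix (Fin (n i)) (Fin (n i)) (AlgebraicClosure K))),
    ∀ x : B, algebraMap K (AlgebraicClosure K) (t x)
      = ∑ i, Matrix.trace (e ((1 : AlgebraicClosure K) ⊗ₜ[K] x) i)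

/-- A bilinear form with invertible Gram determinant admits a dual family to any basis. -/
theorem exists_dual_family {R L ι : Type*} [CommRing R] [AddCommGroup L] [Module R L]
    [Fintype ι] [DecidableEq ι] (b : Module.Basis ι R L) (B : L →ₗ[R] L →ₗ[R] R)
    (h : IsUnit (Matrix.of fun i j => B (b i) (b j)).det) :
    ∃ b' : ι → L, (∀ y, ∑ i, B y (b' i) • b i = y) ∧
      ∀ y, ∑ i, B (b i) y • b' i = y := by
  set G : Matrix ι ι R := Matrix.of fun i j => B (b i) (b j) with hG
  have hd : ∀ i j, B (b i) (∑ k, G⁻¹ k j • b k) = if i = j then 1 else 0 := by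
    intro i j
    have := congrFun (congrFun (G.mul_nonsing_inv h) i) j
    rw [Matrix.mul_apply, Matrix.one_apply] at this
    rw [← this]
    simp [hG, mul_comm]
  refine ⟨fun j => ∑ k, G⁻¹ k j • b k, fun y => ?_, fun y => ?_⟩
  · have : ∑ i, (LinearMap.flip B (∑ k, G⁻¹ k i • b k)).smulRight (b i) = LinearMap.id :=
      b.ext fun j => by simp [-map_sum, -map_smul, hd]
    simpa using LinearMap.congr_fun this y
  · have : ∑ i, (B (b i)).smulRight (∑ k, G⁻¹ k i • b k) = LinearMap.id := by
      refine b.ext fun j => ?_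
      have h2 : ∀ k, ∑ i, G⁻¹ k i * B (b i) (b j) = if k = j then 1 else 0 := fun k => by
        have := congrFun (congrFun (G.nonsing_inv_mul h) k) j
        rwa [Matrix.mul_apply, Matrix.one_apply] at this
      simp only [LinearMap.sum_apply, LinearMap.smulRight_apply, LinearMap.id_apply,
        Finset.smul_sum, smul_smul]
      rw [Finset.sum_comm]
      simp only [← Finset.sum_smul, mul_comm (B _ _), h2]
      simp
    simpa using LinearMap.congr_fun this y

/-- The Casimir element of an associative symmetric form with dual families `b`, `b'`
commutes with the algebra. -/
theorem casimir_comm {R L ι S : Type*} [CommRing R] [Ring L] [Algebra R L] [Ring S] [Algebra R S]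
    [Fintype ι] (B : L →ₗ[R] L →ₗ[R] R) (hB : ∀ x y z, B (x * y) z = B y (z * x))
    (b b' : ι → L) (h₁ : ∀ y, ∑ i, B y (b' i) • b i = y) (h₂ : ∀ y, ∑ i, B (b i) y • b' i = y)
    (π : L →ₐ[R] S) (F : S) (x : L) :
    π x * ∑ i, π (b i) * F * π (b' i) = (∑ i, π (b i) * F * π (b' i)) * π x := by
  calc π x * ∑ i, π (b i) * F * π (b' i)
      = ∑ i, π (x * b i) * F * π (b' i) := by simp [Finset.mul_sum, mul_assoc]
    _ = ∑ i, ∑ j, B (x * b i) (b' j) • (π (b j) * F * π (b' i)) := by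
        refine Finset.sum_congr rfl fun i _ => ?_
        conv_lhs => rw [← h₁ (x * b i)]
        simp [Finset.sum_mul]
    _ = ∑ j, ∑ i, B (b i) (b' j * x) • (π (b j) * F * π (b' i)) := by
        rw [Finset.sum_comm]; simp only [hB]
    _ = ∑ j, π (b j) * F * π (b' j * x) := by
        refine Finset.sum_congr rfl fun j _ => ?_
        conv_rhs => rw [← h₂ (b' j * x)]
        simp [Finset.mul_sum]
    _ = _ := by simp [Finset.sum_mul, mul_assoc]

/-- For the trace form on a product of matrix algebras, `∑ i, b i * a * b' i` is the
componentwise trace of `a`. -/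
theorem casimir_matrix {K ι κ : Type*} [Field K] [Fintype ι] [Fintype κ] {n : κ → ℕ}
    (b b' : ι → (k : κ) → Matrix (Fin (n k)) (Fin (n k)) K)
    (h : ∀ x : (k : κ) → Matrix (Fin (n k)) (Fin (n k)) K,
      ∑ i, (∑ k, (x k * b' i k).trace) • b i = x)
    (a : (k : κ) → Matrix (Fin (n k)) (Fin (n k)) K) (k : κ) :
    (∑ i, b i * a * b' i) k = (a k).trace • 1 := by
  classical
  have key : ∀ p q r s, ∑ i, b i k p r * b' i k s q = if p = q ∧ r = s then 1 else 0 := by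
    intro p q r s
    have h0 := congrFun (congrFun (congrFun (h (Pi.single k (Matrix.single q s 1))) k) p) r
    have h1 : ∀ i, ∑ k', ((Pi.single k (Matrix.single q s (1 : K)) :
        (k : κ) → Matrix (Fin (n k)) (Fin (n k)) K) k' * b' i k').trace = b' i k s q := by
      intro i
      rw [Finset.sum_eq_single k]
      · simp [Matrix.trace_single_mul]
      · intro j _ hj; simp [Pi.single_eq_of_ne hj]
      · simp
    simp only [h1, Finset.sum_apply, Pi.smul_apply, Matrix.sum_apply, Matrix.smul_apply,
      smul_eq_mul, Pi.single_eq_same, Matrix.single_apply] at h0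
    simp only [mul_comm (b _ k p r), h0]
    simp [eq_comm]
  ext p q
  simp only [Finset.sum_apply, Pi.mul_apply, Matrix.sum_apply, Matrix.mul_apply, Finset.sum_mul,
    Matrix.smul_apply, smul_eq_mul, Matrix.one_apply]
  rw [Finset.sum_comm]
  calc _ = ∑ s, ∑ r, a k r s * ∑ i, b i k p r * b' i k s q := by
        refine Finset.sum_congr rfl fun s _ => ?_
        rw [Finset.sum_comm]
        refine Finset.sum_congr rfl fun r _ => ?_
        rw [Finset.mul_sum]
        exact Finset.sum_congr rfl fun i _ => by ring
    _ = _ := by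
        simp only [key]
        by_cases hpq : p = q <;> simp [hpq, Matrix.trace]

theorem exists_not_dvd_forall_dvd_mul {R Z : Type*} [CommRing R] [IsLocalRing R]
    [IsNoetherianRing R] {ϖ : R} (hϖ : IsLocalRing.maximalIdeal R = Ideal.span {ϖ})
    [CommRing Z] [Algebra R Z] [Module.Finite R Z] (I : Ideal Z) (hI : I ≠ ⊤) :
    ∃ x : Z, ¬ algebraMap R Z ϖ ∣ x ∧ ∀ y ∈ I, algebraMap R Z ϖ ∣ x * y := by
  obtain ⟨m, hm, hIm⟩ := I.exists_le_maximal hI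
  have : IsNoetherianRing Z := IsNoetherianRing.of_finite R Z
  have hle : Ideal.span {algebraMap R Z ϖ} ≤ m := by
    rw [Ideal.span_singleton_le_iff_mem, ← Ideal.mem_comap, IsLocalRing.eq_maximalIdeal
      (Ideal.isMaximal_comap_of_isIntegral_of_isMaximal (R := R) m), hϖ]
    exact Ideal.mem_span_singleton_self ϖ
  have hmin : m ∈ (Ideal.span {algebraMap R Z ϖ}).minimalPrimes := by
    refine ⟨⟨hm.isPrime, hle⟩, fun p ⟨hp, hle'⟩ hpm => ?_⟩
    have hmax : (p.comap (algebraMap R Z)).IsMaximal := by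
      have : IsLocalRing.maximalIdeal R ≤ p.comap (algebraMap R Z) := by
        rw [hϖ, Ideal.span_singleton_le_iff_mem, Ideal.mem_comap]
        exact hle' (Ideal.mem_span_singleton_self _)
      rw [← (IsLocalRing.maximalIdeal.isMaximal R).eq_of_le (Ideal.comap_ne_top _ hp.ne_top) this]
      infer_instance
    have := Ideal.isMaximal_of_isIntegral_of_isMaximal_comap p hmax
    exact (this.eq_of_le hm.ne_top hpm).ge
  rw [← Ideal.annihilator_quotient (I := Ideal.span {algebraMap R Z ϖ})] at hmin
  have hass := Module.associatedPrimes.minimalPrimes_annihilator_subset_associatedPrimes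
    Z (Z ⧸ Ideal.span {algebraMap R Z ϖ}) hmin
  obtain ⟨hp, x, hx⟩ := isAssociatedPrime_iff.mp hass
  obtain ⟨x, rfl⟩ := Ideal.Quotient.mk_surjective x
  have hmem : ∀ y, y ∈ m ↔ algebraMap R Z ϖ ∣ x * y := fun y => by
    rw [hx, Submodule.mem_colon_singleton, Submodule.mem_bot, ← Ideal.mem_span_singleton,
      ← Ideal.Quotient.eq_zero_iff_mem, mul_comm, map_mul]
    rfl
  refine ⟨x, fun h => hm.ne_top ((Ideal.eq_top_iff_one m).2 ?_), fun y hy => (hmem y).1 (hIm hy)⟩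
  exact (hmem 1).2 (by simpa using h)

theorem exists_casimir_eq_one {R L ι : Type*} [CommRing R] [IsDomain R] [IsLocalRing R]
    [IsNoetherianRing R] {ϖ : R} (hϖ : IsLocalRing.maximalIdeal R = Ideal.span {ϖ})
    [Ring L] [Algebra R L] [Module.Finite R L] [Module.IsTorsionFree R L] [Fintype ι]
    (hϖ0 : ϖ ≠ 0)
    (B : L →ₗ[R] L →ₗ[R] R) (hB : ∀ x y z, B (x * y) z = B y (z * x))
    (b b' : ι → L) (h₁ : ∀ y, ∑ i, B y (b' i) • b i = y) (h₂ : ∀ y, ∑ i, B (b i) y • b' i = y)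
    (H : ∀ a z, ∑ i, b i * a * b' i = ϖ • z → ϖ ∣ B a 1) :
    ∃ a, ∑ i, b i * a * b' i = 1 := by
  have hc : ∀ a, ∑ i, b i * a * b' i ∈ Subalgebra.center R L := fun a =>
    Subalgebra.mem_center_iff.2 fun x => casimir_comm B hB b b' h₁ h₂ (AlgHom.id R L) a x
  have hcm : ∀ z ∈ Subalgebra.center R L, ∀ a,
      ∑ i, b i * (z * a) * b' i = z * ∑ i, b i * a * b' i := fun z hz a => by
    rw [Finset.mul_sum]
    refine Finset.sum_congr rfl fun i _ => ?_
    rw [← mul_assoc, Subalgebra.mem_center_iff.1 hz (b i)]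
    simp only [mul_assoc]
  have : Module.Finite R (Subalgebra.center R L) :=
    Module.Finite.of_injective (Subalgebra.center R L).val.toLinearMap Subtype.val_injective
  let I : Ideal (Subalgebra.center R L) :=
    { carrier := {z | ∃ a, ∑ i, b i * a * b' i = z}
      zero_mem' := ⟨0, by simp⟩
      add_mem' := by
        rintro x y ⟨u, hu⟩ ⟨v, hv⟩
        exact ⟨u + v, by simp [mul_add, add_mul, Finset.sum_add_distrib, hu, hv]⟩
      smul_mem' := by
        rintro z x ⟨u, hu⟩
        exact ⟨z * u, by rw [hcm z z.2, hu]; rfl⟩ }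
  by_contra hne
  have hI : I ≠ ⊤ := fun h => hne ((Ideal.eq_top_iff_one I).1 h)
  obtain ⟨x, hx, hxI⟩ := exists_not_dvd_forall_dvd_mul hϖ I hI
  have hdvd : ∀ a, ϖ ∣ B (x : L) a := fun a => by
    obtain ⟨z, hz⟩ := hxI ⟨_, hc a⟩ ⟨a, rfl⟩
    have h := H (x * a) z (by
      rw [hcm x x.2, Algebra.smul_def]
      exact congrArg Subtype.val hz)
    rwa [← Subalgebra.mem_center_iff.1 x.2 a, hB, one_mul] at h
  choose f hf using fun i => hdvd (b' i)
  have hxy : (x : L) = ϖ • ∑ i, f i • b i := by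
    conv_lhs => rw [← h₁ x]
    simp only [hf, mul_smul, Finset.smul_sum]
  refine hx ⟨⟨∑ i, f i • b i, Subalgebra.mem_center_iff.2 fun y => ?_⟩, ?_⟩
  · have := Subalgebra.mem_center_iff.1 x.2 y
    rw [hxy, mul_smul_comm, smul_mul_assoc] at this
    exact smul_right_injective L hϖ0 this
  · exact Subtype.ext (hxy.trans (Algebra.smul_def _ _))

theorem dvd_of_casimir_eq_smul {R F K L ι κ : Type*} [CommRing R] [IsDomain R]
    [IsIntegrallyClosed R] [Field F] [Algebra R F] [IsFractionRing R F] [Field K] [Algebra R K]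
    [Algebra F K] [IsScalarTower R F K] [Ring L] [Algebra R L] [Module.Finite R L]
    [Fintype ι] [Fintype κ] {n : κ → ℕ}
    (φ : L →ₐ[R] ((k : κ) → Matrix (Fin (n k)) (Fin (n k)) K))
    (hφ : Submodule.span K (Set.range φ) = ⊤)
    (B : L →ₗ[R] L →ₗ[R] R)
    (hτ : ∀ x y, algebraMap R K (B x y) = ∑ k, (φ x k * φ y k).trace)
    (b b' : ι → L) (h₁ : ∀ y, ∑ i, B y (b' i) • b i = y)
    {ϖ : R} (hϖ : ϖ ≠ 0) (a z : L) (h : ∑ i, b i * a * b' i = ϖ • z) : ϖ ∣ B a 1 := by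
  have hall : ∀ x : (k : κ) → Matrix (Fin (n k)) (Fin (n k)) K,
      ∑ i, (∑ k, (x k * φ (b' i) k).trace) • φ (b i) = x := by
    intro x
    have hx : x ∈ Submodule.span K (Set.range φ) := hφ ▸ Submodule.mem_top
    induction hx using Submodule.span_induction with
    | mem x hx =>
      obtain ⟨y, rfl⟩ := hx
      simp only [← hτ, algebraMap_smul]
      rw [← congrArg φ (h₁ y)]
      simp
    | zero => simp
    | add x y _ _ hx hy =>
      simp only [Pi.add_apply, add_mul, Matrix.trace_add, Finset.sum_add_distrib, add_smul, hx, hy]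
    | smul c x _ hx =>
      simp only [Pi.smul_apply, smul_mul_assoc, Matrix.trace_smul, smul_eq_mul, ← Finset.mul_sum,
        mul_smul, ← Finset.smul_sum, hx]
  have hcas : ∀ k, (φ a k).trace • (1 : Matrix (Fin (n k)) (Fin (n k)) K) = ϖ • φ z k := by
    intro k
    rw [← casimir_matrix _ _ hall (φ a) k, ← Pi.smul_apply, ← map_smul, ← h]
    simp
  have hϖK : algebraMap R K ϖ ≠ 0 := by
    rw [IsScalarTower.algebraMap_apply R F K]
    simpa using hϖ
  have hint : ∀ k, ∃ w : K, IsIntegral R w ∧ (φ a k).trace = algebraMap R K ϖ * w := by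
    intro k
    rcases Nat.eq_zero_or_pos (n k) with h0 | h0
    · have : IsEmpty (Fin (n k)) := by rw [h0]; infer_instance
      exact ⟨0, isIntegral_zero, by simp [Matrix.trace]⟩
    · have : Nonempty (Fin (n k)) := ⟨⟨0, h0⟩⟩
      refine ⟨(algebraMap R K ϖ)⁻¹ * (φ a k).trace, ?_, by field_simp⟩
      have hz : IsIntegral R (φ z k) := by
        have h1 : IsIntegral R z := Algebra.IsIntegral.isIntegral z
        exact (h1.map φ).map (Pi.evalAlgHom R _ k)
      have he : φ z k = algebraMap K (Matrix (Fin (n k)) (Fin (n k)) K)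
          ((algebraMap R K ϖ)⁻¹ * (φ a k).trace) := by
        rw [Algebra.algebraMap_eq_smul_one, mul_smul, hcas, ← algebraMap_smul K ϖ, smul_smul,
          inv_mul_cancel₀ hϖK, one_smul]
      rw [he] at hz
      exact (isIntegral_algebraMap_iff (algebraMap K _).injective).1 hz
  choose w hw hw' using hint
  have hsum : algebraMap R K (B a 1) = algebraMap R K ϖ * ∑ k, w k := by
    rw [hτ, Finset.mul_sum]
    simp [hw']
  have hwF : algebraMap F K (algebraMap R F (B a 1) / algebraMap R F ϖ) = ∑ k, w k := by
    rw [map_div₀, ← IsScalarTower.algebraMap_apply, ← IsScalarTower.algebraMap_apply, hsum,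
      mul_div_cancel_left₀ _ hϖK]
  have hF : IsIntegral R (algebraMap R F (B a 1) / algebraMap R F ϖ) := by
    rw [← isIntegral_algebraMap_iff (algebraMap F K).injective, hwF]
    exact IsIntegral.sum _ fun k _ => hw k
  obtain ⟨r, hr⟩ := IsIntegrallyClosed.isIntegral_iff.1 hF
  refine ⟨r, IsFractionRing.injective R F ?_⟩
  rw [map_mul, hr, mul_div_cancel₀]
  simpa using hϖ

/-- Reduction modulo `c` as an algebra homomorphism on endomorphisms. -/
noncomputable def endQuotHom {R N : Type} [CommRing R] [AddCommGroup N] [Module R N] (c : R) :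
    Module.End R N →ₐ[R] Module.End R (N ⧸ (smulSub c : Submodule R N)) where
  toFun := endQuot c
  map_one' := Submodule.linearMap_qext _ rfl
  map_mul' _ _ := Submodule.linearMap_qext _ rfl
  map_zero' := Submodule.linearMap_qext _ rfl
  map_add' _ _ := Submodule.linearMap_qext _ rfl
  commutes' _ := Submodule.linearMap_qext _ rfl

theorem endQuotHom_apply {R N : Type} [CommRing R] [AddCommGroup N] [Module R N] (c : R)
    (f : Module.End R N) : endQuotHom c f = endQuot c f := rfl

theorem endQuotHom_surjective {R N : Type} [CommRing R] [AddCommGroup N] [Module R N]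
    [Module.Projective R N] (c : R) : Function.Surjective (endQuotHom c (N := N)) := fun φ => by
  obtain ⟨f, hf⟩ := Module.projective_lifting_property (Submodule.mkQ (smulSub c))
    (φ ∘ₗ Submodule.mkQ (smulSub c)) (Submodule.mkQ_surjective _)
  exact ⟨f, Submodule.linearMap_qext _ hf⟩

theorem exists_eq_smul_of_endQuotHom_eq_zero {R N : Type} [CommRing R] [IsDomain R]
    [AddCommGroup N] [Module R N] [Module.IsTorsionFree R N] {c : R} (hc : c ≠ 0)
    {f : Module.End R N} (hf : endQuotHom c f = 0) : ∃ f', f = c • f' := by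
  have hinj : Function.Injective (c • (LinearMap.id : N →ₗ[R] N)) := smul_right_injective N hc
  have hmem : ∀ x, f x ∈ LinearMap.range (c • (LinearMap.id : N →ₗ[R] N)) := fun x =>
    (Submodule.Quotient.mk_eq_zero (smulSub c)).1
      (LinearMap.congr_fun hf (Submodule.Quotient.mk x))
  refine ⟨(LinearEquiv.ofInjective _ hinj).symm.toLinearMap ∘ₗ f.codRestrict _ hmem, ?_⟩
  ext x
  exact (congrArg Subtype.val
    ((LinearEquiv.ofInjective _ hinj).apply_symm_apply (f.codRestrict _ hmem x))).symm

theorem isSemisimpleModule_quotient_smulSub {R N : Type} [CommRing R] [IsPrincipalIdealRing R]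
    [AddCommGroup N] [Module R N] {c : R} (hc : Irreducible c) :
    IsSemisimpleModule R (N ⧸ (smulSub c : Submodule R N)) := by
  have h := Submodule.isSemisimple_torsionBy_of_irreducible
    (M := N ⧸ (smulSub c : Submodule R N)) hc
  refine .of_injective (LinearMap.codRestrict
    (Submodule.torsionBy R (N ⧸ (smulSub c : Submodule R N)) c) LinearMap.id fun x => ?_)
    (fun x y hxy => congrArg Subtype.val hxy)
  obtain ⟨x, rfl⟩ := Submodule.Quotient.mk_surjective _ x
  exact (Submodule.Quotient.mk_eq_zero _).2 ⟨x, rfl⟩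

/-- The subalgebra of endomorphisms mapping a submodule into itself. -/
def stabilizerSubalgebra {R V : Type*} [CommRing R] [AddCommGroup V] [Module R V]
    (p : Submodule R V) : Subalgebra R (Module.End R V) where
  carrier := {f | p.map f ≤ p}
  mul_mem' {f g} hf hg := by
    rintro _ ⟨v, hv, rfl⟩
    exact hf ⟨g v, hg ⟨v, hv, rfl⟩, rfl⟩
  add_mem' {f g} hf hg := by
    rintro _ ⟨v, hv, rfl⟩
    exact p.add_mem (hf ⟨v, hv, rfl⟩) (hg ⟨v, hv, rfl⟩)
  algebraMap_mem' r := by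
    rintro _ ⟨v, hv, rfl⟩
    exact p.smul_mem r hv

section Averaging

variable {R L ι V : Type*} [CommRing R] [Ring L] [Algebra R L] [Fintype ι]
  [AddCommGroup V] [Module R V]

theorem exists_stable_isCompl [IsSemisimpleModule R V] {b b' : ι → L}
    (hb : ∑ i, b i * b' i = 1) (π : L →ₐ[R] Module.End R V)
    (hcomm : ∀ F x, Commute (π x) (∑ i, π (b i) * F * π (b' i)))
    (p : Submodule R V) (hp : ∀ x, p.map (π x) ≤ p) :
    ∃ q : Submodule R V, (∀ x, q.map (π x) ≤ q) ∧ IsCompl p q := by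
  obtain ⟨q, hq⟩ := exists_isCompl p
  set F : Module.End R V := p.subtype ∘ₗ p.projectionOnto q hq with hF
  set E : Module.End R V := ∑ i, π (b i) * F * π (b' i) with hE
  have hp' : ∀ x, ∀ v ∈ p, π x v ∈ p := fun x v hv => hp x ⟨v, hv, rfl⟩
  have hproj : LinearMap.IsProj p E := by
    refine ⟨fun v => ?_, fun v hv => ?_⟩
    · rw [hE, LinearMap.sum_apply]
      exact Submodule.sum_mem _ fun i _ => hp' _ _ (Submodule.coe_mem _)
    · have h1 : ∀ i, (π (b i) * F * π (b' i)) v = π (b i * b' i) v := fun i => by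
        have : F (π (b' i) v) = π (b' i) v :=
          congrArg Subtype.val (Submodule.projectionOnto_apply_left hq ⟨_, hp' (b' i) v hv⟩)
        simp [this]
      rw [hE, LinearMap.sum_apply]
      simp only [h1]
      rw [← LinearMap.sum_apply, ← map_sum, hb, map_one, Module.End.one_apply]
  refine ⟨LinearMap.ker E, ?_, hproj.isCompl⟩
  rintro x _ ⟨v, hv, rfl⟩
  have := LinearMap.congr_fun (hcomm F x) v
  rw [LinearMap.mem_ker]
  simp only [Module.End.mul_apply] at this
  rw [← hE, LinearMap.mem_ker.1 hv, map_zero] at this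
  exact this.symm

theorem isSemisimpleModule_range [IsSemisimpleModule R V] {b b' : ι → L}
    (hb : ∑ i, b i * b' i = 1) (π : L →ₐ[R] Module.End R V)
    (hcomm : ∀ F x, Commute (π x) (∑ i, π (b i) * F * π (b' i))) :
    IsSemisimpleModule π.range V := by
  refine (isSemisimpleModule_iff _ _).2 ⟨fun p => ?_⟩
  obtain ⟨q, hq, hpq⟩ := exists_stable_isCompl hb π hcomm (p.restrictScalars R) (by
    rintro x _ ⟨v, hv, rfl⟩
    exact p.smul_mem (⟨π x, x, rfl⟩ : π.range) hv)
  refine ⟨{ q with smul_mem' := ?_ }, ?_⟩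
  · rintro ⟨_, x, rfl⟩ v hv
    exact hq x ⟨v, hv, rfl⟩
  · rw [isCompl_iff, disjoint_iff, codisjoint_iff] at hpq ⊢
    refine ⟨?_, ?_⟩
    · refine (Submodule.eq_bot_iff _).2 fun v hv => (Submodule.eq_bot_iff _).1 hpq.1 v ?_
      exact ⟨hv.1, hv.2⟩
    · refine Submodule.eq_top_iff'.2 fun v => ?_
      obtain ⟨y, hy, z, hz, h⟩ := Submodule.mem_sup.1 (hpq.2 ▸ Submodule.mem_top : v ∈ _)
      exact Submodule.mem_sup.2 ⟨y, hy, z, hz, h⟩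

theorem isSemisimpleRing_end_range [IsSemisimpleModule R V] [Module.Finite R V] {b b' : ι → L}
    (hb : ∑ i, b i * b' i = 1) (π : L →ₐ[R] Module.End R V)
    (hcomm : ∀ F x, Commute (π x) (∑ i, π (b i) * F * π (b' i))) :
    IsSemisimpleRing (Module.End π.range V) :=
  have := isSemisimpleModule_range hb π hcomm
  have := Module.Finite.of_restrictScalars_finite R π.range V
  IsSemisimpleRing.moduleEnd π.range V

end Averaging

theorem exists_mem_centralizer_endQuotHom_eq {R N : Type} {ι : Type*} [CommRing R]
    [AddCommGroup N] [Module R N] [Module.Projective R N] [Fintype ι]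
    (L : Subalgebra R (Module.End R N)) {b b' : ι → L}
    (hb : ∑ i, b i * b' i = 1)
    (hcomm : ∀ (F : Module.End R N) (x : L), Commute (x : Module.End R N) (∑ i, b i * F * b' i))
    (c : R) (φ : Module.End R (N ⧸ (smulSub c : Submodule R N)))
    (hφ : ∀ x ∈ L, Commute (endQuotHom c x) φ) :
    ∃ f ∈ Subalgebra.centralizer R (L : Set (Module.End R N)), endQuotHom c f = φ := by
  obtain ⟨f, rfl⟩ := endQuotHom_surjective c φ
  refine ⟨∑ i, b i * f * b' i, (Subalgebra.mem_centralizer_iff R).2 fun x hx => hcomm f ⟨x, hx⟩, ?_⟩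
  have h : ∑ i, (b i : Module.End R N) * b' i = 1 := by simpa using congrArg Subtype.val hb
  simp only [map_sum, map_mul, mul_assoc]
  simp only [← (hφ _ (b' _).2).eq]
  simp only [← mul_assoc, ← map_mul]
  rw [← map_sum, ← Finset.sum_mul, h, one_mul]

theorem isSemisimpleRing_zmod_tensor_centralizer {R N : Type} {ι : Type*} [CommRing R]
    [IsDomain R] [IsPrincipalIdealRing R] [AddCommGroup N] [Module R N] [Module.Free R N]
    [Module.Finite R N] [Fintype ι]
    (L : Subalgebra R (Module.End R N)) {b b' : ι → L}
    (hb : ∑ i, b i * b' i = 1)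
    (hcomm : ∀ (S : Type) [Ring S] [Algebra R S] (π : L →ₐ[R] S) (F : S) (x : L),
      Commute (π x) (∑ i, π (b i) * F * π (b' i)))
    (ℓ : ℕ) (hℓ : Irreducible (ℓ : R)) :
    IsSemisimpleRing
      (ZMod ℓ ⊗[ℤ] (Subalgebra.centralizer R (L : Set (Module.End R N)))) := by
  set C := Subalgebra.centralizer R (L : Set (Module.End R N)) with hC
  set V := N ⧸ (smulSub (ℓ : R) : Submodule R N)
  set π : L →ₐ[R] Module.End R V := (endQuotHom (ℓ : R)).comp L.val
  have : IsSemisimpleModule R V := isSemisimpleModule_quotient_smulSub hℓ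
  have : IsSemisimpleRing (Module.End π.range V) :=
    isSemisimpleRing_end_range hb π (hcomm _ π)
  have hcen : ∀ c : C, ∀ x ∈ L, Commute (endQuotHom (ℓ : R) x) (endQuotHom (ℓ : R) c.1) :=
    fun c x hx => Commute.map ((Subalgebra.mem_centralizer_iff R).1 c.2 x hx) _
  let Φ : C →+* Module.End π.range V :=
    { toFun := fun c =>
        { toFun := endQuotHom (ℓ : R) c.1
          map_add' := map_add _
          map_smul' := by
            rintro ⟨_, x, rfl⟩ v
            exact (LinearMap.congr_fun (hcen c x x.2) v).symm }
      map_one' := by ext v; exact LinearMap.congr_fun (map_one (endQuotHom (ℓ : R))) v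
      map_mul' := fun c d => by
        ext v; exact LinearMap.congr_fun (map_mul (endQuotHom (ℓ : R)) c.1 d.1) v
      map_zero' := by ext v; exact LinearMap.congr_fun (map_zero (endQuotHom (ℓ : R))) v
      map_add' := fun c d => by
        ext v; exact LinearMap.congr_fun (map_add (endQuotHom (ℓ : R)) c.1 d.1) v }
  have hΦ : Function.Surjective Φ := fun f => by
    obtain ⟨c, hc, hcf⟩ := exists_mem_centralizer_endQuotHom_eq L hb (hcomm _ L.val) (ℓ : R)
      (f.restrictScalars R) fun x hx =>
        LinearMap.ext fun v => (f.map_smul (⟨π ⟨x, hx⟩, _, rfl⟩ : π.range) v).symm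
    exact ⟨⟨c, hc⟩, LinearMap.ext fun v => LinearMap.congr_fun hcf v⟩
  let Ψ : C →+* ZMod ℓ ⊗[ℤ] C :=
    (Algebra.TensorProduct.includeRight : C →ₐ[ℤ] ZMod ℓ ⊗[ℤ] C).toRingHom
  have hΨ : Function.Surjective Ψ := fun z => by
    induction z using TensorProduct.induction_on with
    | zero => exact ⟨0, map_zero _⟩
    | add x y hx hy =>
      obtain ⟨x, rfl⟩ := hx
      obtain ⟨y, rfl⟩ := hy
      exact ⟨x + y, map_add _ _ _⟩
    | tmul n c =>
      obtain ⟨n, rfl⟩ := ZMod.intCast_surjective n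
      refine ⟨n • c, ?_⟩
      change (1 : ZMod ℓ) ⊗ₜ[ℤ] (n • c) = _
      rw [← TensorProduct.smul_tmul, zsmul_one]
  have hker : RingHom.ker Φ ≤ RingHom.ker Ψ := fun c hc => by
    have h0 : endQuotHom (ℓ : R) c.1 = 0 :=
      LinearMap.ext fun v => LinearMap.congr_fun (RingHom.mem_ker.1 hc) v
    obtain ⟨f, hf⟩ := exists_eq_smul_of_endQuotHom_eq_zero hℓ.ne_zero h0
    have hfC : f ∈ C := by
      refine (Subalgebra.mem_centralizer_iff R).2 fun x hx => ?_
      have := (Subalgebra.mem_centralizer_iff R).1 c.2 x hx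
      rw [hf, mul_smul_comm, smul_mul_assoc] at this
      ext v
      exact smul_right_injective N hℓ.ne_zero (LinearMap.congr_fun this v)
    have hcf : c = (ℓ : ℤ) • (⟨f, hfC⟩ : C) := Subtype.ext <| by
      rw [hf]
      simp [Nat.cast_smul_eq_nsmul]
    rw [RingHom.mem_ker, hcf]
    change (1 : ZMod ℓ) ⊗ₜ[ℤ] ((ℓ : ℤ) • (⟨f, hfC⟩ : C)) = 0
    rw [← TensorProduct.smul_tmul, zsmul_one]
    simp
  refine RingHom.isSemisimpleRing_of_surjective
    (RingHom.liftOfSurjective Φ hΦ ⟨Ψ, hker⟩) fun z => ?_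
  obtain ⟨c, rfl⟩ := hΨ z
  exact ⟨Φ c, RingHom.liftOfRightInverse_comp_apply _ _ _ ⟨Ψ, hker⟩ c⟩

/-- An order whose reduced trace form has discriminant prime to `ℓ` has a separability element
`∑ i, b i ⊗ b' i`. -/
theorem exists_separability_family (ℓ : ℕ) [Fact ℓ.Prime] {L : Type} [Ring L] [Algebra ℤ_[ℓ] L]
    [Module.Free ℤ_[ℓ] L] [Module.Finite ℤ_[ℓ] L]
    (t : (ℚ_[ℓ] ⊗[ℤ_[ℓ]] L) →ₗ[ℚ_[ℓ]] ℚ_[ℓ])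
    (ht : IsReducedTrace ℚ_[ℓ] (ℚ_[ℓ] ⊗[ℤ_[ℓ]] L) t)
    (T : L → L → ℤ_[ℓ])
    (hT : ∀ x y : L, ((T x y : ℤ_[ℓ]) : ℚ_[ℓ])
      = t (((1 : ℚ_[ℓ]) ⊗ₜ[ℤ_[ℓ]] x) * ((1 : ℚ_[ℓ]) ⊗ₜ[ℤ_[ℓ]] y)))
    (hdvd : ¬ ((ℓ : ℤ_[ℓ]) ∣ gramDet ℤ_[ℓ] ℤ_[ℓ] T)) :
    ∃ b b' : Module.Free.ChooseBasisIndex ℤ_[ℓ] L → L, ∑ i, b i * b' i = 1 ∧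
      ∀ (S : Type) [Ring S] [Algebra ℤ_[ℓ] S] (π : L →ₐ[ℤ_[ℓ]] S) (F : S) (x : L),
        Commute (π x) (∑ i, π (b i) * F * π (b' i)) := by
  classical
  have hinj : Function.Injective (algebraMap ℤ_[ℓ] ℚ_[ℓ]) := IsFractionRing.injective _ _
  have hT' : ∀ x y, algebraMap ℤ_[ℓ] ℚ_[ℓ] (T x y) = t ((1 : ℚ_[ℓ]) ⊗ₜ[ℤ_[ℓ]] (x * y)) :=
    fun x y => by
      have := hT x y
      rwa [Algebra.TensorProduct.tmul_mul_tmul, one_mul] at this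
  obtain ⟨m, n, e, he⟩ := ht
  let ψ : L →+* ((i : Fin m) → Matrix (Fin (n i)) (Fin (n i)) (AlgebraicClosure ℚ_[ℓ])) :=
    e.toRingEquiv.toRingHom.comp
      ((Algebra.TensorProduct.includeRight : (ℚ_[ℓ] ⊗[ℤ_[ℓ]] L) →ₐ[ℚ_[ℓ]]
        (AlgebraicClosure ℚ_[ℓ] ⊗[ℚ_[ℓ]] (ℚ_[ℓ] ⊗[ℤ_[ℓ]] L))).toRingHom.comp
      (Algebra.TensorProduct.includeRight : L →ₐ[ℤ_[ℓ]] (ℚ_[ℓ] ⊗[ℤ_[ℓ]] L)).toRingHom)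
  let φ : L →ₐ[ℤ_[ℓ]] ((i : Fin m) → Matrix (Fin (n i)) (Fin (n i)) (AlgebraicClosure ℚ_[ℓ])) :=
    { ψ with
      commutes' := fun r => by
        change e (1 ⊗ₜ (1 ⊗ₜ algebraMap ℤ_[ℓ] L r)) = _
        have h1 : (1 : ℚ_[ℓ]) ⊗ₜ[ℤ_[ℓ]] algebraMap ℤ_[ℓ] L r
            = (algebraMap ℤ_[ℓ] ℚ_[ℓ] r) • (1 : ℚ_[ℓ] ⊗[ℤ_[ℓ]] L) := by
          rw [Algebra.algebraMap_eq_smul_one, TensorProduct.tmul_smul, algebraMap_smul]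
          rfl
        have h2 : (1 : AlgebraicClosure ℚ_[ℓ]) ⊗ₜ[ℚ_[ℓ]]
            ((algebraMap ℤ_[ℓ] ℚ_[ℓ] r) • (1 : ℚ_[ℓ] ⊗[ℤ_[ℓ]] L))
            = algebraMap ℚ_[ℓ] (AlgebraicClosure ℚ_[ℓ]) (algebraMap ℤ_[ℓ] ℚ_[ℓ] r) • 1 := by
          rw [TensorProduct.tmul_smul, algebraMap_smul (AlgebraicClosure ℚ_[ℓ])
            (algebraMap ℤ_[ℓ] ℚ_[ℓ] r)]
          rfl
        rw [h1, h2, map_smul, map_one, ← IsScalarTower.algebraMap_apply, algebraMap_smul,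
          Algebra.algebraMap_eq_smul_one] }
  have hφ : ∀ x, φ x = e (1 ⊗ₜ (1 ⊗ₜ x)) := fun x => rfl
  have hτ : ∀ x y, algebraMap ℤ_[ℓ] (AlgebraicClosure ℚ_[ℓ]) (T x y)
      = ∑ k, (φ x k * φ y k).trace := fun x y => by
    rw [IsScalarTower.algebraMap_apply ℤ_[ℓ] ℚ_[ℓ], hT', he]
    refine Finset.sum_congr rfl fun k _ => ?_
    rw [← hφ, map_mul, Pi.mul_apply]
  have hspan : Submodule.span (AlgebraicClosure ℚ_[ℓ]) (Set.range φ) = ⊤ := by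
    refine Submodule.eq_top_iff'.2 fun z => ?_
    obtain ⟨z, rfl⟩ := e.surjective z
    induction z using TensorProduct.induction_on with
    | zero => rw [map_zero]; exact Submodule.zero_mem _
    | add x y hx hy => rw [map_add]; exact Submodule.add_mem _ hx hy
    | tmul s w =>
      induction w using TensorProduct.induction_on with
      | zero => rw [TensorProduct.tmul_zero, map_zero]; exact Submodule.zero_mem _
      | add x y hx hy =>
        rw [TensorProduct.tmul_add, map_add]; exact Submodule.add_mem _ hx hy
      | tmul q x =>
        have : s ⊗ₜ[ℚ_[ℓ]] (q ⊗ₜ[ℤ_[ℓ]] x)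
            = (q • s) • ((1 : AlgebraicClosure ℚ_[ℓ]) ⊗ₜ[ℚ_[ℓ]] ((1 : ℚ_[ℓ]) ⊗ₜ[ℤ_[ℓ]] x)) := by
          rw [TensorProduct.smul_tmul', smul_eq_mul, mul_one, TensorProduct.smul_tmul,
            TensorProduct.smul_tmul', smul_eq_mul, mul_one]
        rw [this, map_smul, ← hφ]
        exact Submodule.smul_mem _ _ (Submodule.subset_span ⟨x, rfl⟩)
  let B : L →ₗ[ℤ_[ℓ]] L →ₗ[ℤ_[ℓ]] ℤ_[ℓ] := LinearMap.mk₂ ℤ_[ℓ] T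
    (fun x y z => hinj <| by
      simp only [map_add, hT', add_mul, TensorProduct.tmul_add])
    (fun r x y => hinj <| by
      rw [smul_eq_mul, map_mul, hT', hT', smul_mul_assoc, TensorProduct.tmul_smul,
        ← algebraMap_smul ℚ_[ℓ] r, map_smul, smul_eq_mul])
    (fun x y z => hinj <| by
      simp only [map_add, hT', mul_add, TensorProduct.tmul_add])
    (fun r x y => hinj <| by
      rw [smul_eq_mul, map_mul, hT', hT', mul_smul_comm, TensorProduct.tmul_smul,
        ← algebraMap_smul ℚ_[ℓ] r, map_smul, smul_eq_mul])
  have hBT : ∀ x y, B x y = T x y := fun x y => rfl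
  have hB : ∀ x y z, B (x * y) z = B y (z * x) := fun x y z => by
    refine hinj ((algebraMap ℚ_[ℓ] (AlgebraicClosure ℚ_[ℓ])).injective ?_)
    rw [← IsScalarTower.algebraMap_apply, ← IsScalarTower.algebraMap_apply, hBT, hBT, hτ, hτ]
    refine Finset.sum_congr rfl fun k _ => ?_
    rw [map_mul, map_mul, Pi.mul_apply, Pi.mul_apply, mul_assoc, Matrix.trace_mul_comm, mul_assoc]
  have hmax := PadicInt.maximalIdeal_eq_span_p (p := ℓ)
  have hℓ : (ℓ : ℤ_[ℓ]) ≠ 0 := PadicInt.prime_p.ne_zero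
  have hunit : IsUnit (Matrix.of fun i j => B (Module.Free.chooseBasis ℤ_[ℓ] L i)
      (Module.Free.chooseBasis ℤ_[ℓ] L j)).det := by
    by_contra h
    refine hdvd ?_
    rw [← Ideal.mem_span_singleton, ← hmax, IsLocalRing.mem_maximalIdeal]
    simp only [gramDet]
    convert h
    exact (hBT _ _).symm
  obtain ⟨b', h₁, h₂⟩ := exists_dual_family _ B hunit
  obtain ⟨a, ha⟩ := exists_casimir_eq_one hmax hℓ B hB _ b' h₁ h₂ fun a z h =>
    dvd_of_casimir_eq_smul (F := ℚ_[ℓ]) φ hspan B hτ _ b' h₁ hℓ a z h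
  refine ⟨_, b', by simpa using ha, fun S _ _ π F x => ?_⟩
  have : Commute _ _ := casimir_comm B hB _ b' h₁ h₂ π (π a * F) x
  simpa only [map_mul, mul_assoc] using this

/-- let `k` be a field finitely generated over `ℚ`, `A` an abelian variety
over `k` of dimension `g ≥ 1`; abstract the Tate module `N = T_ℓ(A)` with its Galois action
`ρ`, and let `Λ = Λ_ℓ(A)` be the `ℤ_ℓ`-subalgebra of `End(N)` generated by the image of `ρ`.
By Faltings, `Λ ⊗ ℚ_ℓ` is semisimple (hypothesis below), and by the Tate conjecture
`End(A) ⊗ ℤ_ℓ` is the centraliser of `Λ` in `End(N)`.  If `ℓ` does not divide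
`discr(Λ)` (reduced trace form), then: the Galois module `A[ℓ] = N/ℓ` is semisimple,
`End(A)/ℓ` is a semisimple `𝔽_ℓ`-algebra, and `End_Γ(A[ℓ]) = End(A)/ℓ`. -/
theorem stmt16 (ℓ : ℕ) [Fact ℓ.Prime] (g : ℕ) (hg : 1 ≤ g)
    (Γ : Type) [Group Γ]
    (N : Type) [AddCommGroup N] [Module ℤ_[ℓ] N] [Module.Free ℤ_[ℓ] N] [Module.Finite ℤ_[ℓ] N]
    (hrank : Module.finrank ℤ_[ℓ] N = 2 * g)
    (ρ : Γ →* (N ≃ₗ[ℤ_[ℓ]] N))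
    (Λ : Subalgebra ℤ_[ℓ] (Module.End ℤ_[ℓ] N))
    (hΛ : Λ = Algebra.adjoin ℤ_[ℓ] (Set.range fun γ : Γ => (ρ γ).toLinearMap))
    [Module.Free ℤ_[ℓ] Λ] [Module.Finite ℤ_[ℓ] Λ]
    [IsSemisimpleRing (ℚ_[ℓ] ⊗[ℤ_[ℓ]] Λ)]
    (t : (ℚ_[ℓ] ⊗[ℤ_[ℓ]] Λ) →ₗ[ℚ_[ℓ]] ℚ_[ℓ])
    (ht : IsReducedTrace ℚ_[ℓ] (ℚ_[ℓ] ⊗[ℤ_[ℓ]] Λ) t)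
    (T : Λ → Λ → ℤ_[ℓ])
    (hT : ∀ x y : Λ, ((T x y : ℤ_[ℓ]) : ℚ_[ℓ])
      = t (((1 : ℚ_[ℓ]) ⊗ₜ[ℤ_[ℓ]] x) * ((1 : ℚ_[ℓ]) ⊗ₜ[ℤ_[ℓ]] y)))
    (hdvd : ¬ ((ℓ : ℤ_[ℓ]) ∣ gramDet ℤ_[ℓ] ℤ_[ℓ] T)) :
    (∀ p : Submodule ℤ_[ℓ] (N ⧸ (smulSub (ℓ : ℤ_[ℓ]) : Submodule ℤ_[ℓ] N)),
      (∀ γ : Γ, p.map (endQuot (ℓ : ℤ_[ℓ]) (ρ γ).toLinearMap) ≤ p) →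
      ∃ q, (∀ γ : Γ, q.map (endQuot (ℓ : ℤ_[ℓ]) (ρ γ).toLinearMap) ≤ q) ∧ IsCompl p q) ∧
    IsSemisimpleRing
      (ZMod ℓ ⊗[ℤ] (Subalgebra.centralizer ℤ_[ℓ] (Λ : Set (Module.End ℤ_[ℓ] N)))) ∧
    (∀ c ∈ Subalgebra.centralizer ℤ_[ℓ] (Λ : Set (Module.End ℤ_[ℓ] N)), ∀ γ : Γ,
      endQuot (ℓ : ℤ_[ℓ]) c * endQuot (ℓ : ℤ_[ℓ]) (ρ γ).toLinearMap
        = endQuot (ℓ : ℤ_[ℓ]) (ρ γ).toLinearMap * endQuot (ℓ : ℤ_[ℓ]) c) ∧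
    (∀ φ : Module.End ℤ_[ℓ] (N ⧸ (smulSub (ℓ : ℤ_[ℓ]) : Submodule ℤ_[ℓ] N)),
      (∀ γ : Γ, φ * endQuot (ℓ : ℤ_[ℓ]) (ρ γ).toLinearMap
        = endQuot (ℓ : ℤ_[ℓ]) (ρ γ).toLinearMap * φ) →
      ∃ c ∈ Subalgebra.centralizer ℤ_[ℓ] (Λ : Set (Module.End ℤ_[ℓ] N)),
        endQuot (ℓ : ℤ_[ℓ]) c = φ) := by
  obtain ⟨b, b', hb, hcomm⟩ := exists_separability_family ℓ t ht T hT hdvd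
  have hirr : Irreducible (ℓ : ℤ_[ℓ]) := PadicInt.irreducible_p
  have hmem : ∀ γ, (ρ γ).toLinearMap ∈ Λ := fun γ => hΛ ▸ Algebra.subset_adjoin ⟨γ, rfl⟩
  have hind : ∀ A : Subalgebra ℤ_[ℓ] (Module.End ℤ_[ℓ] N),
      (∀ γ, (ρ γ).toLinearMap ∈ A) → ∀ x ∈ Λ, x ∈ A := fun A hA x hx => by
    rw [hΛ] at hx
    exact Algebra.adjoin_le (Set.range_subset_iff.2 hA) hx
  refine ⟨fun p hp => ?_, isSemisimpleRing_zmod_tensor_centralizer Λ hb hcomm ℓ hirr,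
    fun c hc γ => ?_, fun φ hφ => ?_⟩
  · have := isSemisimpleModule_quotient_smulSub (N := N) hirr
    obtain ⟨q, hq, hpq⟩ := exists_stable_isCompl hb ((endQuotHom (ℓ : ℤ_[ℓ])).comp Λ.val)
      (hcomm _ _) p fun x =>
        hind ((stabilizerSubalgebra p).comap (endQuotHom (ℓ : ℤ_[ℓ]))) hp x x.2
    exact ⟨q, fun γ => hq ⟨_, hmem γ⟩, hpq⟩
  · have h := (Subalgebra.mem_centralizer_iff _).1 hc _ (hmem γ)
    rw [← endQuotHom_apply, ← endQuotHom_apply, ← map_mul, ← map_mul, h]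
  · refine exists_mem_centralizer_endQuotHom_eq Λ hb (hcomm _ Λ.val) _ φ fun x hx => ?_
    have h : endQuotHom (ℓ : ℤ_[ℓ]) x ∈ Subalgebra.centralizer ℤ_[ℓ] {φ} :=
      hind ((Subalgebra.centralizer ℤ_[ℓ] {φ}).comap (endQuotHom (ℓ : ℤ_[ℓ])))
        (fun γ => (Subalgebra.mem_centralizer_iff ℤ_[ℓ]).2 (by rintro _ rfl; exact hφ γ)) x hx
    exact ((Subalgebra.mem_centralizer_iff ℤ_[ℓ]).1 h φ rfl).symm
end
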